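/- arXiv:1504.00303 — 10 statements merged into one kernel-verified Lean document; each statement's English description precedes it below -/
import Mathlib

section
/- For all integers a, b, c, the function Φ satisfies the recurrence (R1): Φ(a,b,c)·Φ(a−3,b−3,c−2) = Φ(a−2,b−1,c)·Φ(a−1,b−2,c−2) + Φ(a−1,b−1,c−1)·Φ(a−2,b−2,c−1). -/
def Phi (a b c : ℤ) : ℚ :=
  (2 : ℚ) ^ ((b - c + 1) * (2*b - a - c) + (a - b)^2) *
  (3 : ℚ) ^ ((a - b + c) * (a - b + c - 1) / 2)

def Psi (a b c : ℤ) : ℚ :=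
  (2 : ℚ) ^ ((b - c - 1) * (2*b - a - c) + (a - b)^2) *
  (3 : ℚ) ^ ((a - b + c) * (a - b + c + 1) / 2)

theorem phi_R1 (a b c : ℤ) :
    Phi a b c * Phi (a-3) (b-3) (c-2) =
      Phi (a-2) (b-1) c * Phi (a-1) (b-2) (c-2) +
      Phi (a-1) (b-1) (c-1) * Phi (a-2) (b-2) (c-1) := by
  have key : ∀ a b c t : ℤ, ∀ e : ℤ,
      (b - c + 1) * (2*b - a - c) + (a - b)^2 = e →
      (a - b + c) * (a - b + c - 1) = 2 * t →
      Phi a b c = (2:ℚ)^e * (3:ℚ)^t := by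
    intro a b c t e he ht
    have h : (a - b + c) * (a - b + c - 1) / 2 = t := by omega
    unfold Phi
    rw [he, h]
  obtain ⟨t, ht⟩ : ∃ t, (a - b + c) * (a - b + c - 1) = 2 * t := by
    have h := Int.even_mul_pred_self (a - b + c)
    exact h.two_dvd
  have h2 : (2:ℚ) ≠ 0 := by norm_num
  have h3 : (3:ℚ) ≠ 0 := by norm_num
  rw [key a b c t _ rfl ht,
    key (a-3) (b-3) (c-2) (t - 2*(a-b+c) + 3) _ rfl (by linear_combination ht),
    key (a-2) (b-1) c (t - (a-b+c) + 1) _ rfl (by linear_combination ht),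
    key (a-1) (b-2) (c-2) (t - (a-b+c) + 1) _ rfl (by linear_combination ht),
    key (a-1) (b-1) (c-1) (t - (a-b+c) + 1) _ rfl (by linear_combination ht),
    key (a-2) (b-2) (c-1) (t - (a-b+c) + 1) _ rfl (by linear_combination ht)]
  have comb : ∀ e f s u : ℤ, (2:ℚ)^e * 3^s * (2^f * 3^u) = 2^(e+f) * 3^(s+u) := by
    intro e f s u
    rw [zpow_add₀ h2, zpow_add₀ h3]; ring
  rw [comb, comb, comb]
  set E : ℤ := ((b-1) - (c-1) + 1) * (2*(b-1) - (a-1) - (c-1)) + ((a-1) - (b-1))^2 +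
    (((b-2) - (c-1) + 1) * (2*(b-2) - (a-2) - (c-1)) + ((a-2) - (b-2))^2) with hE
  set T : ℤ := t - (a-b+c) + 1 + (t - (a-b+c) + 1) with hT
  have e1 : (b - c + 1) * (2*b - a - c) + (a - b)^2 +
      (((b-3) - (c-2) + 1) * (2*(b-3) - (a-3) - (c-2)) + ((a-3) - (b-3))^2) = E := by
    rw [hE]; ring
  have e2 : ((b-1) - c + 1) * (2*(b-1) - (a-2) - c) + ((a-2) - (b-1))^2 +
      (((b-2) - (c-2) + 1) * (2*(b-2) - (a-1) - (c-2)) + ((a-1) - (b-2))^2) = E + 1 := by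
    rw [hE]; ring
  have e3 : t + (t - 2*(a-b+c) + 3) = T + 1 := by rw [hT]; ring
  rw [e1, e2, e3, zpow_add_one₀ h2, zpow_add_one₀ h3]
  ring
end

section
/- For all integers a, b, c, the function Ψ satisfies the recurrence (R1): Ψ(a,b,c)·Ψ(a−3,b−3,c−2) = Ψ(a−2,b−1,c)·Ψ(a−1,b−2,c−2) + Ψ(a−1,b−1,c−1)·Ψ(a−2,b−2,c−1). -/
theorem psi_aux (a b c e k : ℤ) (he : (b - c - 1) * (2*b - a - c) + (a - b)^2 = e)
    (hk : (a - b + c) * (a - b + c + 1) = 2 * k) :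
    Psi a b c = (2 : ℚ) ^ e * (3 : ℚ) ^ k := by
  have h : (a - b + c) * (a - b + c + 1) / 2 = k := by omega
  unfold Psi
  rw [he, h]

theorem psi_R1 (a b c : ℤ) :
    Psi a b c * Psi (a-3) (b-3) (c-2) =
      Psi (a-2) (b-1) c * Psi (a-1) (b-2) (c-2) +
      Psi (a-1) (b-1) (c-1) * Psi (a-2) (b-2) (c-1) := by
  obtain ⟨k, hk⟩ : ∃ k, (a - b + c) * (a - b + c + 1) = 2 * k :=
    (Int.even_mul_succ_self (a - b + c)).two_dvd
  obtain ⟨m, hm⟩ : ∃ m, m = k - (a - b + c) := ⟨_, rfl⟩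
  obtain ⟨p, hp⟩ : ∃ p, p = (b - c - 1) * (2*b - a - c) + (a - b)^2 := ⟨_, rfl⟩
  obtain ⟨q, hq⟩ : ∃ q, q = (b - c - 2) * (2*b - a - c - 1) + (a - b)^2 := ⟨_, rfl⟩
  obtain ⟨r, hr⟩ : ∃ r, r = (b - c - 2) * (2*b - a - c) + (a - b - 1)^2 := ⟨_, rfl⟩
  have h3 : (3 : ℚ) ≠ 0 := by norm_num
  have h2 : (2 : ℚ) ≠ 0 := by norm_num
  rw [psi_aux a b c p k (by rw [hp]) hk,
    psi_aux (a-3) (b-3) (c-2) q (m + m + 1 - k) (by rw [hq]; ring) (by rw [hm]; linarith),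
    psi_aux (a-2) (b-1) c r m (by rw [hr]; ring) (by rw [hm]; linarith),
    psi_aux (a-1) (b-2) (c-2) (p + q + 1 - r) m (by rw [hp, hq, hr]; ring) (by rw [hm]; linarith),
    psi_aux (a-1) (b-1) (c-1) p m (by rw [hp]; ring) (by rw [hm]; linarith),
    psi_aux (a-2) (b-2) (c-1) q m (by rw [hq]; ring) (by rw [hm]; linarith)]
  rw [zpow_sub₀ h3, zpow_sub₀ h2, zpow_add₀ h3, zpow_add₀ h3, zpow_add₀ h2, zpow_add₀ h2,
    zpow_one, zpow_one]
  have hk0 := zpow_ne_zero k h3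
  have hr0 := zpow_ne_zero r h2
  generalize (3:ℚ)^k = K at *
  generalize (2:ℚ)^r = R at *
  field_simp
  ring
end

section
/- For all integers a, b, c, the function Φ satisfies the recurrence (R2): Φ(a,b,c)·Φ(a−2,b−2,c) = Φ(a−1,b−1,c)² + Φ(a,b,c+1)·Φ(a−2,b−2,c−1). -/
theorem phi_eq_aux (a b c E T : ℤ) (hE : (b - c + 1) * (2*b - a - c) + (a - b)^2 = E)
    (hT : (a - b + c) * (a - b + c - 1) = 2 * T) :
    Phi a b c = (2 : ℚ) ^ E * (3 : ℚ) ^ T := by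
  unfold Phi
  rw [hE, hT, Int.mul_ediv_cancel_left _ (by norm_num)]

theorem phi_R2 (a b c : ℤ) :
    Phi a b c * Phi (a-2) (b-2) c =
      Phi (a-1) (b-1) c ^ 2 + Phi a b (c+1) * Phi (a-2) (b-2) (c-1) := by
  obtain ⟨T, hT⟩ : ∃ T, (a - b + c) * (a - b + c - 1) = 2 * T :=
    (Int.even_mul_pred_self (a - b + c)).two_dvd
  obtain ⟨E, hE⟩ : ∃ E, (b - c) * (2*b - a - c - 1) + (a - b)^2 = E := ⟨_, rfl⟩
  obtain ⟨u, hu⟩ : ∃ u, (b - c) + (2*b - a - c) = u := ⟨_, rfl⟩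
  obtain ⟨n, hn⟩ : ∃ n, a - b + c = n := ⟨_, rfl⟩
  rw [phi_eq_aux a b c (E + u) T (by linear_combination hE + hu) hT,
    phi_eq_aux (a-2) (b-2) c (E - u + 2) T (by linear_combination hE - hu)
      (by linear_combination hT),
    phi_eq_aux (a-1) (b-1) c E T (by linear_combination hE) (by linear_combination hT),
    phi_eq_aux a b (c+1) E (T + n) (by linear_combination hE)
      (by linear_combination hT + 2 * hn),
    phi_eq_aux (a-2) (b-2) (c-1) E (T - n + 1) (by linear_combination hE)
      (by linear_combination hT - 2 * hn)]
  have h2 : (2 : ℚ) ≠ 0 := by norm_num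
  have h3 : (3 : ℚ) ≠ 0 := by norm_num
  have e1 : (2 : ℚ) ^ (E + u) * 2 ^ (E - u + 2) = 4 * (2 ^ E * 2 ^ E) := by
    rw [← zpow_add₀ h2, ← zpow_add₀ h2, show E + u + (E - u + 2) = (E + E) + 2 by ring,
      zpow_add₀ h2 (E + E)]
    norm_num
    ring
  have e2 : (3 : ℚ) ^ (T + n) * 3 ^ (T - n + 1) = 3 * (3 ^ T * 3 ^ T) := by
    rw [← zpow_add₀ h3, ← zpow_add₀ h3, show T + n + (T - n + 1) = (T + T) + 1 by ring,
      zpow_add₀ h3 (T + T)]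
    norm_num
    ring
  linear_combination (3 ^ T * 3 ^ T) * e1 - (2 ^ E * 2 ^ E) * e2
end

section
/- For all integers a, b, c, the function Ψ satisfies the recurrence (R2): Ψ(a,b,c)·Ψ(a−2,b−2,c) = Ψ(a−1,b−1,c)² + Ψ(a,b,c+1)·Ψ(a−2,b−2,c−1). -/
theorem psi_R2 (a b c : ℤ) :
    Psi a b c * Psi (a-2) (b-2) c =
      Psi (a-1) (b-1) c ^ 2 + Psi a b (c+1) * Psi (a-2) (b-2) (c-1) := by
  obtain ⟨t, ht⟩ : ∃ t, (a - b + c) * (a - b + c + 1) = 2 * t := by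
    obtain ⟨t, ht⟩ := Int.even_mul_succ_self (a - b + c)
    exact ⟨t, by rw [ht]; ring⟩
  have h2 : (2 : ℚ) ≠ 0 := by norm_num
  have h3 : (3 : ℚ) ≠ 0 := by norm_num
  have e1 : (a - b + c) * (a - b + c + 1) / 2 = t := by omega
  have e2 : (a - 2 - (b - 2) + c) * (a - 2 - (b - 2) + c + 1) / 2 = t := by
    rw [show a - 2 - (b - 2) = a - b by ring]; exact e1
  have e3 : (a - 1 - (b - 1) + c) * (a - 1 - (b - 1) + c + 1) / 2 = t := by
    rw [show a - 1 - (b - 1) = a - b by ring]; exact e1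
  have e4 : (a - b + (c + 1)) * (a - b + (c + 1) + 1) / 2 = t + (a - b + c) + 1 := by
    rw [show (a - b + (c + 1)) * (a - b + (c + 1) + 1) = 2 * (t + (a - b + c) + 1) by
      linear_combination ht]
    omega
  have e5 : (a - 2 - (b - 2) + (c - 1)) * (a - 2 - (b - 2) + (c - 1) + 1) / 2
      = t - (a - b + c) := by
    rw [show (a - 2 - (b - 2) + (c - 1)) * (a - 2 - (b - 2) + (c - 1) + 1)
      = 2 * (t - (a - b + c)) by linear_combination ht]
    omega
  unfold Psi
  rw [e1, e2, e3, e4, e5]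
  have key : ∀ x y z w : ℤ, (2 : ℚ) ^ x * 3 ^ y * (2 ^ z * 3 ^ w) = 2 ^ (x + z) * 3 ^ (y + w) := by
    intro x y z w
    rw [zpow_add₀ h2, zpow_add₀ h3]; ring
  rw [pow_two ((2 : ℚ) ^ _ * 3 ^ _), key, key, key]
  set E : ℤ := 2 * ((b - c - 2) * (2 * b - a - c - 1) + (a - b) ^ 2) with hE
  rw [show (b - c - 1) * (2*b - a - c) + (a - b)^2 +
        ((b - 2 - c - 1) * (2*(b - 2) - (a - 2) - c) + (a - 2 - (b - 2))^2) = E + 2 by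
        rw [hE]; ring,
    show (b - 1 - c - 1) * (2*(b - 1) - (a - 1) - c) + (a - 1 - (b - 1))^2 +
        ((b - 1 - c - 1) * (2*(b - 1) - (a - 1) - c) + (a - 1 - (b - 1))^2) = E by
        rw [hE]; ring,
    show (b - (c + 1) - 1) * (2*b - a - (c + 1)) + (a - b)^2 +
        ((b - 2 - (c - 1) - 1) * (2*(b - 2) - (a - 2) - (c - 1)) + (a - 2 - (b - 2))^2) = E by
        rw [hE]; ring,
    show t + (a - b + c) + 1 + (t - (a - b + c)) = t + t + 1 by ring,
    zpow_add₀ h2 E 2, zpow_add₀ h3 (t + t) 1]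
  norm_num
  ring
end

section
/- For all integers a, b, the pair (Φ, Ψ) satisfies the first equation of the recurrence (R3): Φ(a,b,0)·Φ(a−2,b−2,0) = Φ(a−1,b−1,0)² + Φ(a,b,1)·Ψ(3b−2a+1, 2b−a+1, 1). -/
theorem phi_psi_R3_first (a b : ℤ) :
    Phi a b 0 * Phi (a-2) (b-2) 0 =
      Phi (a-1) (b-1) 0 ^ 2 + Phi a b 1 * Psi (3*b - 2*a + 1) (2*b - a + 1) 1 := by
  obtain ⟨d, rfl⟩ : ∃ d, a = b + d := ⟨a - b, by ring⟩
  obtain ⟨t, ht⟩ : ∃ t, d * (d - 1) = 2 * t := by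
    have h := Int.even_mul_pred_self d
    obtain ⟨t, ht⟩ := h
    exact ⟨t, by rw [ht]; ring⟩
  have h2 : (2:ℚ) ≠ 0 := by norm_num
  have h3 : (3:ℚ) ≠ 0 := by norm_num
  have e : d ^ 2 = 2 * t + d := by linarith
  have key : ∀ x y : ℤ, x = 2 * y → x / 2 = y := by intro x y h; omega
  have A : Phi (b+d) b 0 = 2 ^ ((b*(b-d-1)+d^2) + (2*b-d)) * 3 ^ t := by
    unfold Phi
    rw [key _ t (by linear_combination ht)]
    congr 2; ring
  have B : Phi (b+d-2) (b-2) 0 = 2 ^ ((b*(b-d-1)+d^2) + 2 - (2*b-d)) * 3 ^ t := by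
    unfold Phi
    rw [key _ t (by linear_combination ht)]
    congr 2; ring
  have C : Phi (b+d-1) (b-1) 0 = 2 ^ (b*(b-d-1)+d^2) * 3 ^ t := by
    unfold Phi
    rw [key _ t (by linear_combination ht)]
    congr 2; ring
  have D : Phi (b+d) b 1 = 2 ^ (b*(b-d-1)+d^2) * 3 ^ (t + d) := by
    unfold Phi
    rw [key _ (t + d) (by linear_combination ht)]
    congr 2; ring
  have F : Psi (3*b - 2*(b+d) + 1) (2*b - (b+d) + 1) 1
      = 2 ^ (b*(b-d-1)+d^2) * 3 ^ (t + 1 - d) := by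
    unfold Psi
    rw [key _ (t + 1 - d) (by linear_combination ht)]
    congr 2; ring
  rw [A, B, C, D, F]
  generalize b*(b-d-1)+d^2 = m
  generalize 2*b-d = n
  rw [zpow_sub₀ h2, zpow_sub₀ h3, zpow_add₀ h2, zpow_add₀ h2, zpow_add₀ h3, zpow_add₀ h3]
  have := zpow_ne_zero n h2
  have := zpow_ne_zero d h3
  field_simp
  norm_num
end

section
/- For all integers a, b, the pair (Ψ, Φ) satisfies the second equation of the recurrence (R3): Ψ(a,b,0)·Ψ(a−2,b−2,0) = Ψ(a−1,b−1,0)² + Ψ(a,b,1)·Φ(3b−2a−1, 2b−a−1, 1). -/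
theorem psi_phi_R3_second (a b : ℤ) :
    Psi a b 0 * Psi (a-2) (b-2) 0 =
      Psi (a-1) (b-1) 0 ^ 2 + Psi a b 1 * Phi (3*b - 2*a - 1) (2*b - a - 1) 1 := by
  obtain ⟨T, hT⟩ : ∃ T, (a - b) * (a - b + 1) = 2 * T :=
    (Int.even_mul_succ_self (a - b)).two_dvd
  have h2 : (2 : ℚ) ≠ 0 := by norm_num
  have h3 : (3 : ℚ) ≠ 0 := by norm_num
  have e1 : (a - b + 0) * (a - b + 0 + 1) / 2 = T := by
    have : (a - b + 0) * (a - b + 0 + 1) = 2 * T := by linear_combination hT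
    omega
  have e2 : ((a-2) - (b-2) + 0) * ((a-2) - (b-2) + 0 + 1) / 2 = T := by
    have : ((a-2) - (b-2) + 0) * ((a-2) - (b-2) + 0 + 1) = 2 * T := by linear_combination hT
    omega
  have e3 : ((a-1) - (b-1) + 0) * ((a-1) - (b-1) + 0 + 1) / 2 = T := by
    have : ((a-1) - (b-1) + 0) * ((a-1) - (b-1) + 0 + 1) = 2 * T := by linear_combination hT
    omega
  have e4 : (a - b + 1) * (a - b + 1 + 1) / 2 = T + (a - b) + 1 := by
    have : (a - b + 1) * (a - b + 1 + 1) = 2 * (T + (a - b) + 1) := by linear_combination hT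
    omega
  have e5 : ((3*b - 2*a - 1) - (2*b - a - 1) + 1) * ((3*b - 2*a - 1) - (2*b - a - 1) + 1 - 1) / 2
      = T - (a - b) := by
    have : ((3*b - 2*a - 1) - (2*b - a - 1) + 1) * ((3*b - 2*a - 1) - (2*b - a - 1) + 1 - 1)
      = 2 * (T - (a - b)) := by linear_combination hT
    omega
  unfold Psi Phi
  rw [e1, e2, e3, e4, e5]
  have key : ∀ p q r s t X d : ℤ, p + q = 2 * X + 2 → r = X → s + t = 2 * X →
      (2:ℚ)^p * 3^T * (2^q * 3^T) = (2^r * 3^T)^2 + 2^s * 3^(T + d + 1) * (2^t * 3^(T - d)) := by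
    intro p q r s t X d hpq hr hst
    have l1 : (2:ℚ)^p * 2^q = 4 * (2^X * 2^X) := by
      rw [← zpow_add₀ h2, hpq, zpow_add₀ h2, two_mul, zpow_add₀ h2]; norm_num; ring
    have l2 : (2:ℚ)^s * 2^t = 2^X * 2^X := by
      rw [← zpow_add₀ h2, hst, two_mul, zpow_add₀ h2]
    have l3 : (3:ℚ)^(T + d + 1) * 3^(T - d) = 3 * (3^T * 3^T) := by
      rw [← zpow_add₀ h3, show T + d + 1 + (T - d) = T + T + 1 by ring, zpow_add₀ h3,
        zpow_add₀ h3, zpow_one]; ring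
    subst hr
    linear_combination (3:ℚ)^T * 3^T * l1 - (3:ℚ)^(T + d + 1) * 3^(T - d) * l2
      - (2:ℚ)^r * 2^r * l3
  apply key (X := (b - 2) * (2*b - a - 1) + (a - b)^2) <;> ring
end

section
/- For all integers a, b, c, the function Φ satisfies the recurrence (R4): Φ(a,b,c)·Φ(a−2,b−3,c−2) = Φ(a−1,b−1,c)·Φ(a−1,b−2,c−2) + Φ(a−2,b−2,c−1)·Φ(a,b−1,c−1). -/
theorem phi_R4 (a b c : ℤ) :
    Phi a b c * Phi (a-2) (b-3) (c-2) =
      Phi (a-1) (b-1) c * Phi (a-1) (b-2) (c-2) +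
      Phi (a-2) (b-2) (c-1) * Phi a (b-1) (c-1) := by 
  have h2 : (2 : ℚ) ≠ 0 := by norm_num
  have key : ∀ (e₁ e₂ e₃ e₄ e₅ e₆ s t : ℤ), e₁ + e₂ = e₃ + e₄ + 1 → e₅ + e₆ = e₃ + e₄ →
      ((2:ℚ)^e₁ * 3^s) * (2^e₂ * 3^t) =
        (2^e₃ * 3^s) * (2^e₄ * 3^t) + (2^e₅ * 3^t) * (2^e₆ * 3^s) := by
    intro e₁ e₂ e₃ e₄ e₅ e₆ s t h h'
    have A : (2:ℚ)^e₁ * 2^e₂ = 2^e₃ * 2^e₄ * 2 := by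
      rw [← zpow_add₀ h2, ← zpow_add₀ h2, h, zpow_add_one₀ h2]
    have B : (2:ℚ)^e₅ * 2^e₆ = 2^e₃ * 2^e₄ := by
      rw [← zpow_add₀ h2, ← zpow_add₀ h2, h']
    linear_combination (3:ℚ)^s * 3^t * A - (3:ℚ)^s * 3^t * B
  unfold Phi
  rw [show a - 2 - (b - 3) + (c - 2) = a - b + c - 1 by ring,
    show a - 1 - (b - 1) + c = a - b + c by ring,
    show a - 1 - (b - 2) + (c - 2) = a - b + c - 1 by ring,
    show a - 2 - (b - 2) + (c - 1) = a - b + c - 1 by ring,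
    show a - (b - 1) + (c - 1) = a - b + c by ring]
  apply key <;> ring
end

section
/- For all integers a, b, c, the function Ψ satisfies the recurrence (R4): Ψ(a,b,c)·Ψ(a−2,b−3,c−2) = Ψ(a−1,b−1,c)·Ψ(a−1,b−2,c−2) + Ψ(a−2,b−2,c−1)·Ψ(a,b−1,c−1). -/
theorem psi_R4 (a b c : ℤ) :
    Psi a b c * Psi (a-2) (b-3) (c-2) =
      Psi (a-1) (b-1) c * Psi (a-1) (b-2) (c-2) +
      Psi (a-2) (b-2) (c-1) * Psi a (b-1) (c-1) := by 
  have h2 : (2:ℚ) ≠ 0 := by norm_num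
  have key : ∀ (m n p q u v t w : ℤ), m + n = p + q + 1 →
      u + v = p + q →
      ((2:ℚ)^m * 3^t) * (2^n * 3^w) =
        (2^p * 3^t) * (2^q * 3^w) + (2^u * 3^w) * (2^v * 3^t) := by
    intro m n p q u v t w h h'
    have e1 : (2:ℚ)^m * 2^n = 2 * (2^p * 2^q) := by
      rw [← zpow_add₀ h2, h, zpow_add₀ h2, zpow_add₀ h2, zpow_one]; ring
    have e2 : (2:ℚ)^u * 2^v = 2^p * 2^q := by
      rw [← zpow_add₀ h2, h', zpow_add₀ h2]
    linear_combination ((3:ℚ)^t * 3^w) * e1 - ((3:ℚ)^t * 3^w) * e2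
  unfold Psi
  have s1 : a - 2 - (b - 3) + (c - 2) = a - b + c - 1 := by ring
  have s2 : a - 1 - (b - 1) + c = a - b + c := by ring
  have s3 : a - 1 - (b - 2) + (c - 2) = a - b + c - 1 := by ring
  have s4 : a - 2 - (b - 2) + (c - 1) = a - b + c - 1 := by ring
  have s5 : a - (b - 1) + (c - 1) = a - b + c := by ring
  rw [s1, s2, s3, s4, s5]
  apply key <;> ring
end

section
/- For all integers a, b, c, the function Φ satisfies the recurrence (R5): Φ(a,b,c)·Φ(a−2,b−3,c−2) = Φ(c,b−1,a−1)·Φ(a−1,b−2,c−2) + Φ(a−2,b−2,c−1)·Φ(a,b−1,c−1). -/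
theorem Phi_eq_aux (a b c m n t : ℤ)
    (hm : (b - c + 1) * (2*b - a - c) + (a - b)^2 = m)
    (hn : a - b + c = n) (ht : n * (n - 1) / 2 = t) :
    Phi a b c = (2 : ℚ) ^ m * (3 : ℚ) ^ t := by
  subst hm hn ht
  rfl

theorem phi_R5 (a b c : ℤ) :
    Phi a b c * Phi (a-2) (b-3) (c-2) =
      Phi c (b-1) (a-1) * Phi (a-1) (b-2) (c-2) +
      Phi (a-2) (b-2) (c-1) * Phi a (b-1) (c-1) := by
  obtain ⟨q, hq⟩ : ∃ q, q = (b-c)^2 - (b-c)*(a-b) + (a-b)^2 := ⟨_, rfl⟩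
  obtain ⟨s, hs⟩ : ∃ s, s = a - b + c := ⟨_, rfl⟩
  rw [Phi_eq_aux a b c (q + (b-c) - (a-b)) s _ (by rw [hq]; ring) (by rw [hs]) rfl,
    Phi_eq_aux (a-2) (b-3) (c-2) (q - 2*(b-c) + 2*(a-b) + 1) (s-1) _
      (by rw [hq]; ring) (by rw [hs]; ring) rfl,
    Phi_eq_aux c (b-1) (a-1) (q - (b-c)) s _ (by rw [hq]; ring) (by rw [hs]; ring) rfl,
    Phi_eq_aux (a-1) (b-2) (c-2) (q + (a-b)) (s-1) _
      (by rw [hq]; ring) (by rw [hs]; ring) rfl,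
    Phi_eq_aux (a-2) (b-2) (c-1) (q - (b-c)) (s-1) _
      (by rw [hq]; ring) (by rw [hs]; ring) rfl,
    Phi_eq_aux a (b-1) (c-1) (q + (a-b)) s _
      (by rw [hq]; ring) (by rw [hs]; ring) rfl]
  have h2 : (2:ℚ) ^ (q + (b-c) - (a-b)) * (2:ℚ) ^ (q - 2*(b-c) + 2*(a-b) + 1)
      = 2 * ((2:ℚ) ^ (q - (b-c)) * (2:ℚ) ^ (q + (a-b))) := by
    rw [← zpow_add₀ (by norm_num), ← zpow_add₀ (by norm_num),
      ← zpow_one_add₀ (by norm_num)]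
    congr 1
    ring
  linear_combination (3:ℚ) ^ (s * (s - 1) / 2) * (3:ℚ) ^ ((s-1) * (s - 1 - 1) / 2) * h2
end

section
/- For all integers a, b, c, the function Ψ satisfies the recurrence (R5): Ψ(a,b,c)·Ψ(a−2,b−3,c−2) = Ψ(c,b−1,a−1)·Ψ(a−1,b−2,c−2) + Ψ(a−2,b−2,c−1)·Ψ(a,b−1,c−1). -/
theorem psi_aux_s9 (m n p q : ℤ) :
    ((2 : ℚ) ^ m * (3 : ℚ) ^ p) * ((2 : ℚ) ^ n * (3 : ℚ) ^ q) =
      (2 : ℚ) ^ (m + n) * ((3 : ℚ) ^ p * (3 : ℚ) ^ q) := by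
  rw [zpow_add₀ (by norm_num)]; ring

theorem psi_R5 (a b c : ℤ) :
    Psi a b c * Psi (a-2) (b-3) (c-2) =
      Psi c (b-1) (a-1) * Psi (a-1) (b-2) (c-2) +
      Psi (a-2) (b-2) (c-1) * Psi a (b-1) (c-1) := by
  unfold Psi
  rw [show (a - 2 - (b - 3) + (c - 2)) = a - b + c - 1 by ring,
    show (c - (b - 1) + (a - 1)) = a - b + c by ring,
    show (a - 1 - (b - 2) + (c - 2)) = a - b + c - 1 by ring,
    show (a - 2 - (b - 2) + (c - 1)) = a - b + c - 1 by ring,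
    show (a - (b - 1) + (c - 1)) = a - b + c by ring]
  simp only [psi_aux_s9]
  generalize (3 : ℚ) ^ ((a - b + c) * (a - b + c + 1) / 2) = X
  generalize (3 : ℚ) ^ ((a - b + c - 1) * (a - b + c - 1 + 1) / 2) = Y
  generalize hN : (b - 1 - (a - 1) - 1) * (2 * (b - 1) - c - (a - 1)) + (c - (b - 1)) ^ 2 +
    ((b - 2 - (c - 2) - 1) * (2 * (b - 2) - (a - 1) - (c - 2)) + (a - 1 - (b - 2)) ^ 2) = N
  rw [show (b - c - 1) * (2 * b - a - c) + (a - b) ^ 2 +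
      ((b - 3 - (c - 2) - 1) * (2 * (b - 3) - (a - 2) - (c - 2)) + (a - 2 - (b - 3)) ^ 2) = N + 1
      by rw [← hN]; ring,
    show (b - 2 - (c - 1) - 1) * (2 * (b - 2) - (a - 2) - (c - 1)) + (a - 2 - (b - 2)) ^ 2 +
      ((b - 1 - (c - 1) - 1) * (2 * (b - 1) - a - (c - 1)) + (a - (b - 1)) ^ 2) = N
      by rw [← hN]; ring,
    zpow_add_one₀ (by norm_num)]
  ring
end
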